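/- arXiv:2305.14939 — 2 statements merged into one kernel-verified Lean document; each statement's English description precedes it below -/
import Mathlib

section
/- Let a, b ∈ Δₙ be strictly positive probability vectors, C ∈ ℝ₊^{n×n}, γ > 0, K := exp(−C/γ), and δ > 0. Let (f_k, g_k) be the Sinkhorn iterates started from arbitrary f₀, g₀ ∈ ℝⁿ and P_k := diag(e^{f_k/γ}) K diag(e^{g_k/γ}). Then there exists an iteration index k with k ≤ 2 + 2⌈2‖C‖_∞/(γδ)⌉ such that ‖a − P_k𝟏ₙ‖₁ + ‖b − P_kᵀ𝟏ₙ‖₁ ≤ δ. -/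
/-- The dual entropic OT objective
`h(f,g) = ⟨f,a⟩ + ⟨g,b⟩ − γ Σ_{i,j} exp((f_i + g_j − C_{ij})/γ)`. -/
noncomputable def dualObj {n : ℕ} (a b : Fin n → ℝ) (C : Matrix (Fin n) (Fin n) ℝ)
    (γ : ℝ) (f g : Fin n → ℝ) : ℝ :=
  (∑ i, f i * a i) + (∑ j, g j * b j) -
    γ * ∑ i, ∑ j, Real.exp ((f i + g j - C i j) / γ)

/-- The transport plan `P = diag(e^{f/γ}) K diag(e^{g/γ})` with `K = exp(−C/γ)`. -/
noncomputable def plan {n : ℕ} (C : Matrix (Fin n) (Fin n) ℝ) (γ : ℝ)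
    (f g : Fin n → ℝ) : Matrix (Fin n) (Fin n) ℝ :=
  fun i j => Real.exp (f i / γ) * Real.exp (-C i j / γ) * Real.exp (g j / γ)

/-- `(f k, g k)` is the sequence of Sinkhorn iterates (in dual form): for even `k`,
`f (k+1) = γ log a − γ log (K e^{g k / γ})` and `g (k+1) = g k`; for odd `k`,
`f (k+1) = f k` and `g (k+1) = γ log b − γ log (Kᵀ e^{f k / γ})`,
where `K = exp(−C/γ)`. -/
def SinkhornSeq {n : ℕ} (a b : Fin n → ℝ) (C : Matrix (Fin n) (Fin n) ℝ) (γ : ℝ)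
    (f g : ℕ → Fin n → ℝ) : Prop :=
  ∀ k : ℕ,
    (Even k →
      f (k+1) = (fun i => γ * Real.log (a i) -
        γ * Real.log (∑ j, Real.exp (-C i j / γ) * Real.exp (g k j / γ))) ∧
      g (k+1) = g k) ∧
    (¬ Even k →
      f (k+1) = f k ∧
      g (k+1) = (fun j => γ * Real.log (b j) -
        γ * Real.log (∑ i, Real.exp (-C i j / γ) * Real.exp (f k i / γ))))

/-- A rational lower bound for the logarithm, exact to third order at `1`. -/
lemma le_log_of_pos {t : ℝ} (ht : 0 < t) :
    (t - 1) * (5 * t + 1) / (2 * t * (t + 2)) ≤ Real.log t := by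
  set F : ℝ → ℝ := fun x => Real.log x - (x - 1) * (5 * x + 1) / (2 * x * (x + 2)) with hF
  have hderiv : ∀ x : ℝ, 0 < x → HasDerivAt F ((x - 1) ^ 3 / (x ^ 2 * (x + 2) ^ 2)) x := by
    intro x hx
    have hnum : HasDerivAt (fun y : ℝ => (y - 1) * (5 * y + 1))
        (1 * (5 * x + 1) + (x - 1) * (5 * 1)) x :=
      ((hasDerivAt_id x).sub_const 1).mul (((hasDerivAt_id x).const_mul 5).add_const 1)
    have hden : HasDerivAt (fun y : ℝ => 2 * y * (y + 2))
        (2 * 1 * (x + 2) + 2 * x * 1) x :=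
      ((hasDerivAt_id x).const_mul 2).mul ((hasDerivAt_id x).add_const 2)
    have hne : 2 * x * (x + 2) ≠ 0 := by positivity
    refine ((Real.hasDerivAt_log hx.ne').sub (hnum.div hden hne)).congr_deriv ?_
    have : x + 2 ≠ 0 := by positivity
    field_simp
    ring
  have hmin : IsMinOn F (Set.Ioi 0) 1 := by
    refine isMinOn_Ioi_of_deriv (hderiv 1 one_pos).continuousAt
      (fun x hx => (hderiv x hx.1).differentiableAt.differentiableWithinAt)
      (fun x hx => (hderiv x (one_pos.trans hx)).differentiableAt.differentiableWithinAt)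
      (fun x hx => ?_) (fun x hx => ?_)
    · rw [(hderiv x hx.1).deriv]
      refine div_nonpos_of_nonpos_of_nonneg ?_ (by positivity)
      exact (Odd.pow_nonpos_iff (by decide)).2 (by linarith [hx.2])
    · rw [(hderiv x (one_pos.trans hx)).deriv]
      have : 0 ≤ x - 1 := sub_nonneg.2 (le_of_lt hx)
      positivity
  have h := hmin (Set.mem_Ioi.2 ht)
  simp only [hF, Set.mem_ofPred_eq, Real.log_one] at h
  norm_num at h
  exact h

lemma sq_sub_le_mul_kl {p q : ℝ} (hp : 0 < p) (hq : 0 < q) :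
    (p - q) ^ 2 ≤ (2 / 3 * (p + 2 * q)) * (p * Real.log (p / q) - p + q) := by
  have h := le_log_of_pos (div_pos hp hq)
  have h' : (p - q) * (5 * p + q) / (2 * p * (p + 2 * q)) ≤ Real.log (p / q) := by
    convert h using 1
    field_simp
  have hpos : 0 < 2 / 3 * (p + 2 * q) := by positivity
  calc (p - q) ^ 2
      = (2 / 3 * (p + 2 * q)) *
          (p * ((p - q) * (5 * p + q) / (2 * p * (p + 2 * q))) - p + q) := by
        field_simp
        ring
    _ ≤ _ := by gcongr

/-- **Pinsker's inequality** for strictly positive probability vectors. -/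
lemma pinsker {ι : Type*} [Fintype ι] {p q : ι → ℝ} (hp : ∀ i, 0 < p i) (hq : ∀ i, 0 < q i)
    (hp1 : ∑ i, p i = 1) (hq1 : ∑ i, q i = 1) :
    (∑ i, |p i - q i|) ^ 2 ≤ 2 * ∑ i, p i * Real.log (p i / q i) := by
  have hpos : ∀ i, 0 < 2 / 3 * (p i + 2 * q i) := fun i => by
    have := hp i; have := hq i; positivity
  have hmul := fun i => sq_sub_le_mul_kl (hp i) (hq i)
  refine (Finset.sum_sq_le_sum_mul_sum_of_sq_le_mul Finset.univ
    (f := fun i => 2 / 3 * (p i + 2 * q i))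
    (g := fun i => p i * Real.log (p i / q i) - p i + q i)
    (fun i _ => (hpos i).le)
    (fun i _ => nonneg_of_mul_nonneg_right ((sq_nonneg _).trans (hmul i)) (hpos i))
    (fun i _ => by rw [sq_abs]; exact hmul i)).trans_eq ?_
  simp only [← Finset.mul_sum, Finset.sum_add_distrib, Finset.sum_sub_distrib, hp1, hq1]
  ring

/-- Pairing a vector of oscillation at most `2 L` with a vector of zero sum. -/
lemma sum_mul_le_of_sub_le {ι : Type*} [Fintype ι] {v x : ι → ℝ} {L : ℝ}
    (hv : ∀ i j, v i - v j ≤ 2 * L) (hx : ∑ i, x i = 0) :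
    ∑ i, v i * x i ≤ L * ∑ i, |x i| := by
  cases isEmpty_or_nonempty ι
  · simp
  obtain ⟨m, hm⟩ := Finite.exists_min v
  calc ∑ i, v i * x i = ∑ i, (v i - (v m + L)) * x i := by
        simp only [sub_mul, Finset.sum_sub_distrib, ← Finset.mul_sum, hx, mul_zero, sub_zero]
    _ ≤ ∑ i, L * |x i| := by
        refine Finset.sum_le_sum fun i _ => (le_abs_self _).trans ?_
        rw [abs_mul]
        gcongr
        rw [abs_le]
        constructor <;> linarith [hm i, hv i m]
    _ = L * ∑ i, |x i| := (Finset.mul_sum ..).symm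

/-- Two-phase rate: an objective `H` that grows by at least `γ / 2 * e²` per step and whose gap is
at most `L * e` reaches `e ≤ δ` within `2 N` steps as soon as `2 * L ≤ N * (γ * δ)`. -/
lemma exists_error_le_of_ascent {H e : ℕ → ℝ} {γ δ L : ℝ} {N : ℕ} (hγ : 0 < γ) (hδ : 0 < δ)
    (hL : 0 ≤ L) (hN : 2 * L ≤ N * (γ * δ))
    (hstep : ∀ m, H m + γ / 2 * e m ^ 2 ≤ H (m + 1))
    (hgap : ∀ M m, H M - H m ≤ L * e m) :
    ∃ m ≤ 2 * N, e m ≤ δ := by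
  by_contra! hcon
  have hmono : Monotone H := monotone_nat_of_le_succ fun m => by
    have : 0 ≤ γ / 2 * e m ^ 2 := by positivity
    linarith [hstep m]
  set T := H (2 * N + 1) with hT
  have hnonneg : ∀ m ≤ 2 * N + 1, 0 ≤ T - H m := fun m hm => sub_nonneg.2 (hmono hm)
  have hrec : ∀ m, m ≤ 2 * N + 1 → γ * m * (T - H m) ≤ 2 * L ^ 2 := by
    intro m
    induction m with
    | zero => intro _; simp; positivity
    | succ m ih =>
      intro hm
      have h0 := hnonneg m (by omega)
      have h1 := hnonneg (m + 1) hm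
      have hg := hgap (2 * N + 1) m
      have hs := hstep m
      have ih := ih (by omega)
      rcases hL.eq_or_lt with rfl | hLpos
      · have : T - H (m + 1) = 0 := by
          have := hmono (Nat.le_succ m)
          simp only [Nat.succ_eq_add_one] at this
          linarith
        simp [this]
      · have hsq : (T - H m) ^ 2 ≤ L ^ 2 * e m ^ 2 := by
          rw [← mul_pow]; gcongr
        set x := γ * (T - H m) / (2 * L ^ 2) with hx
        have hD : γ * (T - H m) = 2 * L ^ 2 * x := by rw [hx]; field_simp
        have hx0 : 0 ≤ x := by positivity
        have hmx : m * x ≤ 1 := by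
          have : 2 * L ^ 2 * (m * x) ≤ 2 * L ^ 2 * 1 := by linear_combination ih - m * hD
          exact le_of_mul_le_mul_left this (by positivity)
        have hdec : γ * (T - H (m + 1)) ≤ 2 * L ^ 2 * (x * (1 - x)) := by
          have h2 : 2 * L ^ 2 * x ^ 2 ≤ γ * (γ / 2 * e m ^ 2) := by
            have : (2 * L ^ 2 * x) ^ 2 ≤ γ ^ 2 * (L ^ 2 * e m ^ 2) := by
              rw [← hD, mul_pow]; gcongr
            have : 2 * L ^ 2 * (2 * L ^ 2 * x ^ 2) ≤ 2 * L ^ 2 * (γ * (γ / 2 * e m ^ 2)) := by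
              linarith
            exact le_of_mul_le_mul_left this (by positivity)
          nlinarith
        have hx1 : 0 ≤ 1 - x := by
          have : 0 ≤ 2 * L ^ 2 * (x * (1 - x)) := le_trans (by positivity) hdec
          rcases hx0.eq_or_lt with h | h
          · rw [← h]; norm_num
          · exact nonneg_of_mul_nonneg_right (nonneg_of_mul_nonneg_right this (by positivity)) h
        have hfin : (m + 1) * (x * (1 - x)) ≤ 1 := by nlinarith
        push_cast
        calc γ * (m + 1) * (T - H (m + 1)) = (m + 1) * (γ * (T - H (m + 1))) := by ring
          _ ≤ (m + 1) * (2 * L ^ 2 * (x * (1 - x))) := by gcongr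
          _ = 2 * L ^ 2 * ((m + 1) * (x * (1 - x))) := by ring
          _ ≤ 2 * L ^ 2 * 1 := by gcongr
          _ = 2 * L ^ 2 := mul_one _
  have hlin : ∀ s, s ≤ N + 1 → s * (γ / 2 * δ ^ 2) ≤ H (N + s) - H N := by
    intro s
    induction s with
    | zero => simp
    | succ s ih =>
      intro hs
      have := ih (by omega)
      have h1 : γ / 2 * δ ^ 2 ≤ γ / 2 * e (N + s) ^ 2 := by
        have := hcon (N + s) (by omega)
        gcongr
      have h2 := hstep (N + s)
      rw [← Nat.add_assoc]
      push_cast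
      linarith
  have h1 := hlin (N + 1) le_rfl
  rw [show N + (N + 1) = 2 * N + 1 by omega, ← hT] at h1
  have h2 := hrec N (by omega)
  have hsq : (2 * L) ^ 2 ≤ (N * (γ * δ)) ^ 2 := by gcongr
  push_cast at h1
  rcases Nat.eq_zero_or_pos N with rfl | hNpos
  · have : L = 0 := by
      simp at hN; linarith
    have h3 := hgap (2 * 0 + 1) 0
    rw [this] at h3
    have : 0 < γ / 2 * δ ^ 2 := by positivity
    simp only [← hT] at h3
    norm_num at h1
    linarith
  · have hN' : (0 : ℝ) < N := by exact_mod_cast hNpos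
    have h3 := mul_le_mul_of_nonneg_left h1 (by positivity : 0 ≤ γ * N)
    have : 0 < γ * N * (γ / 2 * δ ^ 2) := by positivity
    nlinarith

/-- One exact block maximization of the dual objective in its first variable. -/
noncomputable def sinkhornUpdate {n : ℕ} (a : Fin n → ℝ) (C : Matrix (Fin n) (Fin n) ℝ) (γ : ℝ)
    (g : Fin n → ℝ) : Fin n → ℝ :=
  fun i => γ * Real.log (a i) -
    γ * Real.log (∑ j, Real.exp (-C i j / γ) * Real.exp (g j / γ))

section Sinkhorn

variable {n : ℕ} {a b : Fin n → ℝ} {C : Matrix (Fin n) (Fin n) ℝ} {γ L : ℝ}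
  {f g f' g' : Fin n → ℝ}

lemma plan_pos (i j : Fin n) : 0 < plan C γ f g i j := by
  unfold plan; positivity

lemma plan_eq_exp (i j : Fin n) :
    plan C γ f g i j = Real.exp ((f i + g j - C i j) / γ) := by
  rw [plan, ← Real.exp_add, ← Real.exp_add]
  congr 1
  ring

lemma plan_transpose (i j : Fin n) : plan C.transpose γ g f j i = plan C γ f g i j := by
  simp only [plan, Matrix.transpose_apply]; ring

lemma dualObj_transpose : dualObj b a C.transpose γ g f = dualObj a b C γ f g := by
  simp only [dualObj, Matrix.transpose_apply]
  rw [Finset.sum_comm, add_comm (∑ i, g i * b i)]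
  simp only [add_comm (g _)]

lemma dualObj_eq_plan : dualObj a b C γ f g =
    (∑ i, f i * a i) + (∑ j, g j * b j) - γ * ∑ i, ∑ j, plan C γ f g i j := by
  simp only [dualObj, plan_eq_exp]

lemma nonempty_of_sum_eq_one (ha1 : ∑ i, a i = 1) : Nonempty (Fin n) := by
  by_contra h
  rw [not_nonempty_iff] at h
  simp at ha1

lemma kernel_sum_pos [Nonempty (Fin n)] (i : Fin n) :
    0 < ∑ j, Real.exp (-C i j / γ) * Real.exp (g j / γ) :=
  Finset.sum_pos (fun _ _ => by positivity) Finset.univ_nonempty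

lemma sum_plan_eq (i : Fin n) : ∑ j, plan C γ f g i j =
    Real.exp (f i / γ) * ∑ j, Real.exp (-C i j / γ) * Real.exp (g j / γ) := by
  simp only [plan, Finset.mul_sum, mul_assoc]

lemma sum_plan_sinkhornUpdate [Nonempty (Fin n)] (hγ : 0 < γ) (ha0 : ∀ i, 0 < a i) (i : Fin n) :
    ∑ j, plan C γ (sinkhornUpdate a C γ g) g i j = a i := by
  have hS := kernel_sum_pos (C := C) (γ := γ) (g := g) i
  rw [sum_plan_eq, sinkhornUpdate, ← mul_sub, mul_div_cancel_left₀ _ hγ.ne', Real.exp_sub,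
    Real.exp_log (ha0 i), Real.exp_log hS, div_mul_cancel₀ _ hS.ne']

lemma sinkhornUpdate_sub [Nonempty (Fin n)] (hγ : 0 < γ) (ha0 : ∀ i, 0 < a i) (i : Fin n) :
    sinkhornUpdate a C γ g i - f i = γ * Real.log (a i / ∑ j, plan C γ f g i j) := by
  have hS := kernel_sum_pos (C := C) (γ := γ) (g := g) i
  rw [sum_plan_eq, Real.log_div (ha0 i).ne' (by positivity),
    Real.log_mul (Real.exp_pos _).ne' hS.ne', Real.log_exp, sinkhornUpdate]
  field_simp
  ring

lemma sum_plan_eq_one (hb1 : ∑ j, b j = 1) (hcol : ∀ j, ∑ i, plan C γ f g i j = b j) :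
    ∑ i, ∑ j, plan C γ f g i j = 1 :=
  Finset.sum_comm.trans <| (Finset.sum_congr rfl fun j _ => hcol j).trans hb1

/-- A block update increases the dual objective by `γ` times a relative entropy, hence by a multiple
of the squared marginal error. -/
lemma dualObj_add_le_sinkhornUpdate (hγ : 0 < γ) (ha0 : ∀ i, 0 < a i) (ha1 : ∑ i, a i = 1)
    (hmass : ∑ i, ∑ j, plan C γ f g i j = 1) :
    dualObj a b C γ f g + γ / 2 * (∑ i, |a i - ∑ j, plan C γ f g i j|) ^ 2 ≤
      dualObj a b C γ (sinkhornUpdate a C γ g) g := by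
  have := nonempty_of_sum_eq_one ha1
  have hpin := pinsker ha0
    (fun i => Finset.sum_pos (fun j _ => plan_pos (C := C) (γ := γ) (f := f) (g := g) i j)
      Finset.univ_nonempty) ha1 hmass
  have hsub : (∑ i, sinkhornUpdate a C γ g i * a i) - ∑ i, f i * a i =
      γ * ∑ i, a i * Real.log (a i / ∑ j, plan C γ f g i j) := by
    rw [← Finset.sum_sub_distrib, Finset.mul_sum]
    refine Finset.sum_congr rfl fun i _ => ?_
    rw [← sub_mul, sinkhornUpdate_sub hγ ha0]
    ring
  rw [dualObj_eq_plan, dualObj_eq_plan, hmass]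
  simp only [sum_plan_sinkhornUpdate hγ ha0, ha1]
  have := mul_le_mul_of_nonneg_left hpin (by positivity : 0 ≤ γ / 2)
  linarith

/-- Concavity of the dual objective: it lies below its linearization. -/
lemma dualObj_sub_le (hγ : 0 < γ) : dualObj a b C γ f' g' - dualObj a b C γ f g ≤
    (∑ i, (f' i - f i) * (a i - ∑ j, plan C γ f g i j)) +
      ∑ j, (g' j - g j) * (b j - ∑ i, plan C γ f g i j) := by
  have hpt : ∀ i j, plan C γ f g i j * (γ + ((f' i - f i) + (g' j - g j))) ≤
      γ * plan C γ f' g' i j := by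
    intro i j
    have hexp : plan C γ f' g' i j = plan C γ f g i j *
        Real.exp (((f' i - f i) + (g' j - g j)) / γ) := by
      rw [plan_eq_exp, plan_eq_exp, ← Real.exp_add]
      congr 1
      ring
    have h := Real.add_one_le_exp (((f' i - f i) + (g' j - g j)) / γ)
    have hP := plan_pos (C := C) (γ := γ) (f := f) (g := g) i j
    calc _ = γ * (plan C γ f g i j * (((f' i - f i) + (g' j - g j)) / γ + 1)) := by
          field_simp
          ring
      _ ≤ _ := by rw [hexp]; gcongr
  have hsum := Finset.sum_le_sum fun i (_ : i ∈ Finset.univ) =>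
    Finset.sum_le_sum fun j (_ : j ∈ Finset.univ) => hpt i j
  have hcomm : ∑ j, (g' j - g j) * ∑ i, plan C γ f g i j =
      ∑ i, ∑ j, plan C γ f g i j * (g' j - g j) := by
    rw [Finset.sum_comm]
    simp only [Finset.mul_sum, mul_comm]
  have hrow : ∑ i, (f' i - f i) * ∑ j, plan C γ f g i j =
      ∑ i, ∑ j, plan C γ f g i j * (f' i - f i) := by
    simp only [mul_comm (f' _ - f _), Finset.sum_mul]
  simp only [mul_add, Finset.sum_add_distrib, ← Finset.mul_sum, ← Finset.sum_mul] at hsum hrow hcomm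
  simp only [mul_sub _ (a _), mul_sub _ (b _), Finset.sum_sub_distrib]
  rw [dualObj_eq_plan, dualObj_eq_plan, hcomm, hrow]
  simp only [sub_mul, Finset.sum_sub_distrib]
  linarith

/-- The soft-min part of a Sinkhorn update has oscillation at most `L`. -/
lemma log_kernel_sum_sub_le [Nonempty (Fin n)] (hγ : 0 < γ) (hC : ∀ i j, 0 ≤ C i j)
    (hL : ∀ i j, C i j ≤ L) (i i' : Fin n) :
    γ * Real.log (∑ j, Real.exp (-C i j / γ) * Real.exp (g j / γ)) -
      γ * Real.log (∑ j, Real.exp (-C i' j / γ) * Real.exp (g j / γ)) ≤ L := by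
  have hS := kernel_sum_pos (C := C) (γ := γ) (g := g) i
  have hS' := kernel_sum_pos (C := C) (γ := γ) (g := g) i'
  have hle : ∑ j, Real.exp (-C i j / γ) * Real.exp (g j / γ) ≤
      Real.exp (L / γ) * ∑ j, Real.exp (-C i' j / γ) * Real.exp (g j / γ) := by
    rw [Finset.mul_sum]
    refine Finset.sum_le_sum fun j _ => ?_
    rw [← mul_assoc, ← Real.exp_add (L / γ), ← add_div]
    gcongr
    linarith [hC i j, hL i' j]
  have hlog := Real.log_le_log hS hle
  rw [Real.log_mul (Real.exp_pos _).ne' hS'.ne', Real.log_exp] at hlog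
  have := mul_le_mul_of_nonneg_left hlog hγ.le
  rw [mul_add, mul_div_cancel₀ _ hγ.ne'] at this
  linarith

lemma sinkhornUpdate_sub_sub_le [Nonempty (Fin n)] (hγ : 0 < γ) (hC : ∀ i j, 0 ≤ C i j)
    (hL : ∀ i j, C i j ≤ L) (i i' : Fin n) :
    (sinkhornUpdate a C γ g' i - sinkhornUpdate a C γ g i) -
      (sinkhornUpdate a C γ g' i' - sinkhornUpdate a C γ g i') ≤ 2 * L := by
  have h1 := log_kernel_sum_sub_le (g := g) hγ hC hL i i'
  have h2 := log_kernel_sum_sub_le (g := g') hγ hC hL i' i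
  simp only [sinkhornUpdate]
  linarith

/-- Comparison of two dual points whose first components are Sinkhorn updates, when the column
marginals of the second one are exact. -/
lemma dualObj_sub_le_mul_error (hγ : 0 < γ) (ha1 : ∑ i, a i = 1) (hb1 : ∑ j, b j = 1)
    (hC : ∀ i j, 0 ≤ C i j) (hL : ∀ i j, C i j ≤ L)
    {u v : Fin n → ℝ} (hf : f = sinkhornUpdate a C γ u) (hf' : f' = sinkhornUpdate a C γ v)
    (hcol : ∀ j, ∑ i, plan C γ f g i j = b j) :
    dualObj a b C γ f' g' - dualObj a b C γ f g ≤
      L * ∑ i, |a i - ∑ j, plan C γ f g i j| := by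
  have := nonempty_of_sum_eq_one ha1
  refine (dualObj_sub_le hγ).trans ?_
  simp only [hcol, sub_self, mul_zero, Finset.sum_const_zero, add_zero]
  refine sum_mul_le_of_sub_le (fun i j => ?_) ?_
  · rw [hf, hf']
    exact sinkhornUpdate_sub_sub_le hγ hC hL i j
  · rw [Finset.sum_sub_distrib, ha1, sum_plan_eq_one hb1 hcol, sub_self]

end Sinkhorn

/-- **Iteration complexity of the vanilla Sinkhorn algorithm** (Theorem 1 of the
paper): for any accuracy `δ > 0`, there is an iteration index
`k ≤ 2 + 2⌈2‖C‖_∞/(γδ)⌉` such that `‖a − P_k𝟏‖₁ + ‖b − P_kᵀ𝟏‖₁ ≤ δ`. -/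
theorem sinkhorn_iteration_complexity {n : ℕ} (a b : Fin n → ℝ)
    (C : Matrix (Fin n) (Fin n) ℝ) (γ : ℝ) (hγ : 0 < γ)
    (ha0 : ∀ i, 0 < a i) (hb0 : ∀ j, 0 < b j)
    (ha1 : ∑ i, a i = 1) (hb1 : ∑ j, b j = 1)
    (hC : ∀ i j, 0 ≤ C i j)
    (f g : ℕ → Fin n → ℝ) (hiter : SinkhornSeq a b C γ f g)
    (δ : ℝ) (hδ : 0 < δ) :
    ∃ k : ℕ, (k : ℤ) ≤ 2 + 2 * ⌈2 * (⨆ i, ⨆ j, |C i j|) / (γ * δ)⌉ ∧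
      (∑ i, |a i - ∑ j, plan C γ (f k) (g k) i j|) +
        (∑ j, |b j - ∑ i, plan C γ (f k) (g k) i j|) ≤ δ := by
  have := nonempty_of_sum_eq_one ha1
  set L := ⨆ i, ⨆ j, |C i j|
  have hL : ∀ i j, C i j ≤ L := fun i j =>
    (le_abs_self _).trans <| (le_ciSup (Set.finite_range fun j => |C i j|).bddAbove j).trans
      (le_ciSup (Set.finite_range fun i => ⨆ j, |C i j|).bddAbove i)
  have hL0 : 0 ≤ L := Real.iSup_nonneg fun i => Real.iSup_nonneg fun j => abs_nonneg _
  have heven : ∀ k, Even k → f (k + 1) = sinkhornUpdate a C γ (g k) ∧ g (k + 1) = g k :=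
    fun k hk => (hiter k).1 hk
  have hodd : ∀ k, ¬ Even k → f (k + 1) = f k ∧ g (k + 1) = sinkhornUpdate b C.transpose γ (f k) :=
    fun k hk => (hiter k).2 hk
  have hupdated : ∀ m, (∃ u, f (m + 2) = sinkhornUpdate a C γ u) ∧
      ∃ v, g (m + 2) = sinkhornUpdate b C.transpose γ v := by
    intro m
    induction m with
    | zero =>
      obtain ⟨h1, -⟩ := heven 0 (by decide)
      obtain ⟨h2, h3⟩ := hodd 1 (by decide)
      exact ⟨⟨_, h2.trans h1⟩, _, h3⟩
    | succ m ih =>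
      by_cases hm : Even (m + 2)
      · exact ⟨⟨_, (heven _ hm).1⟩, by rw [(heven _ hm).2]; exact ih.2⟩
      · exact ⟨by rw [(hodd _ hm).1]; exact ih.1, _, (hodd _ hm).2⟩
  have hrow : ∀ m, ¬ Even (m + 2) → ∀ i, ∑ j, plan C γ (f (m + 2)) (g (m + 2)) i j = a i := by
    intro m hm
    have hm' : Even (m + 1) := by
      by_contra h
      exact hm (Nat.even_add_one.2 h)
    rw [(heven _ hm').1, (heven _ hm').2]
    exact sum_plan_sinkhornUpdate hγ ha0
  have hcol : ∀ m, Even (m + 2) → ∀ j, ∑ i, plan C γ (f (m + 2)) (g (m + 2)) i j = b j := by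
    intro m hm j
    have hm' : ¬ Even (m + 1) := Nat.even_add_one.1 hm
    rw [(hodd _ hm').1, (hodd _ hm').2]
    simp only [← plan_transpose (C := C)]
    exact sum_plan_sinkhornUpdate hγ hb0 j
  set e : ℕ → ℝ := fun m => (∑ i, |a i - ∑ j, plan C γ (f (m + 2)) (g (m + 2)) i j|) +
    (∑ j, |b j - ∑ i, plan C γ (f (m + 2)) (g (m + 2)) i j|) with he
  set H : ℕ → ℝ := fun m => dualObj a b C γ (f (m + 2)) (g (m + 2)) with hH
  have hstep : ∀ m, H m + γ / 2 * e m ^ 2 ≤ H (m + 1) := by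
    intro m
    by_cases hm : Even (m + 2)
    · have hc := hcol m hm
      have h := dualObj_add_le_sinkhornUpdate (b := b) (C := C) (f := f (m + 2)) (g := g (m + 2))
        hγ ha0 ha1 (sum_plan_eq_one hb1 hc)
      rw [← (heven _ hm).1] at h
      simpa [hH, he, hc, Nat.add_right_comm m 1 2, (heven _ hm).2] using h
    · have hr := hrow m hm
      have h := dualObj_add_le_sinkhornUpdate (b := a) (C := C.transpose) (f := g (m + 2))
        (g := f (m + 2)) hγ hb0 hb1
        (sum_plan_eq_one ha1 (by simpa only [plan_transpose] using hr))
      rw [← (hodd _ hm).2] at h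
      simpa [hH, he, hr, Nat.add_right_comm m 1 2, (hodd _ hm).1, plan_transpose,
        dualObj_transpose] using h
  have hgap : ∀ M m, H M - H m ≤ L * e m := by
    intro M m
    obtain ⟨⟨u', hu'⟩, v', hv'⟩ := hupdated M
    obtain ⟨⟨u, hu⟩, v, hv⟩ := hupdated m
    by_cases hm : Even (m + 2)
    · have hc := hcol m hm
      simpa [hH, he, hc] using dualObj_sub_le_mul_error (g' := g (M + 2)) hγ ha1 hb1 hC hL hu hu' hc
    · have hr := hrow m hm
      have h := dualObj_sub_le_mul_error (C := C.transpose) (g := f (m + 2)) (g' := f (M + 2))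
        hγ hb1 ha1 (fun i j => hC j i) (fun i j => hL j i) hv hv'
        (by simpa only [plan_transpose] using hr)
      simpa [hH, he, hr, plan_transpose, dualObj_transpose] using h
  have hceil : 0 ≤ ⌈2 * L / (γ * δ)⌉ := Int.ceil_nonneg (by positivity)
  obtain ⟨N, hN⟩ := Int.eq_ofNat_of_zero_le hceil
  have hN' : 2 * L ≤ N * (γ * δ) := by
    rw [← div_le_iff₀ (by positivity)]
    have := Int.le_ceil (2 * L / (γ * δ))
    rw [hN] at this
    exact_mod_cast this
  obtain ⟨m, hm, hem⟩ := exists_error_le_of_ascent hγ hδ hL0 hN' hstep hgap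
  refine ⟨m + 2, ?_, hem⟩
  rw [hN]
  push_cast
  omega
end

section
/- Let a, b ∈ ℝ_{++}ⁿ be strictly positive probability vectors, C ∈ ℝ₊^{n×n}, γ > 0, K := exp(−C/γ), and δ > 0. Let (f_k, g_k) be the Greenkhorn iterates initialized at (f₀, g₀) = (γ log a, γ log b): with P_k := diag(e^{f_k/γ}) K diag(e^{g_k/γ}), I maximizing i ↦ ρ(a_i, (P_k𝟏ₙ)_i) and J maximizing j ↦ ρ(b_j, (P_kᵀ𝟏ₙ)_j), the coordinate f_I is updated to γ log a_I − γ log(K e^{g_k/γ})_I if ρ(a_I,(P_k𝟏ₙ)_I) > ρ(b_J,(P_kᵀ𝟏ₙ)_J), and otherwise g_J is updated to γ log b_J − γ log(Kᵀ e^{f_k/γ})_J. Then there exists an iteration index k with k ≤ 2⌈56n‖C‖_∞/(γδ)⌉ + 2⌈4n‖C‖_∞/γ⌉ such that ‖a − P_k𝟏ₙ‖₁ + ‖b − P_kᵀ𝟏ₙ‖₁ ≤ δ. -/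
/-- The scalar Bregman divergence `ρ(x,y) = y − x + x log(x/y)`. -/
noncomputable def rho (x y : ℝ) : ℝ := y - x + x * Real.log (x / y)

/-- `(f k, g k)` is the sequence of Greenkhorn iterates (in dual form),
initialized at `(γ log a, γ log b)`.  At step `k`, with `P_k` the current plan,
`I` a maximizer of `i ↦ ρ(a_i, (P_k𝟏)_i)` and `J` a maximizer of
`j ↦ ρ(b_j, (P_kᵀ𝟏)_j)`, the coordinate `f_I` is updated to
`γ log a_I − γ log (K e^{g_k/γ})_I` if `ρ(a_I,(P_k𝟏)_I) > ρ(b_J,(P_kᵀ𝟏)_J)`,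
and otherwise `g_J` is updated to `γ log b_J − γ log (Kᵀ e^{f_k/γ})_J`. -/
def GreenkhornSeq {n : ℕ} (a b : Fin n → ℝ) (C : Matrix (Fin n) (Fin n) ℝ) (γ : ℝ)
    (f g : ℕ → Fin n → ℝ) : Prop :=
  f 0 = (fun i => γ * Real.log (a i)) ∧
  g 0 = (fun j => γ * Real.log (b j)) ∧
  ∀ k : ℕ, ∃ I J : Fin n,
    (∀ i, rho (a i) (∑ j, plan C γ (f k) (g k) i j) ≤
      rho (a I) (∑ j, plan C γ (f k) (g k) I j)) ∧
    (∀ j, rho (b j) (∑ i, plan C γ (f k) (g k) i j) ≤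
      rho (b J) (∑ i, plan C γ (f k) (g k) i J)) ∧
    (rho (b J) (∑ i, plan C γ (f k) (g k) i J) <
        rho (a I) (∑ j, plan C γ (f k) (g k) I j) →
      f (k+1) = Function.update (f k) I (γ * Real.log (a I) -
          γ * Real.log (∑ j, Real.exp (-C I j / γ) * Real.exp (g k j / γ))) ∧
      g (k+1) = g k) ∧
    (¬ (rho (b J) (∑ i, plan C γ (f k) (g k) i J) <
        rho (a I) (∑ j, plan C γ (f k) (g k) I j)) →
      f (k+1) = f k ∧
      g (k+1) = Function.update (g k) J (γ * Real.log (b J) -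
          γ * Real.log (∑ i, Real.exp (-C i J / γ) * Real.exp (f k i / γ))))

/-! ### The divergence `rho` -/

lemma sq_sqrt_sub_sqrt_le_rho {x y : ℝ} (hx : 0 < x) (hy : 0 < y) :
    (√x - √y) ^ 2 ≤ rho x y := by
  have hsx : 0 < √x := Real.sqrt_pos.2 hx
  have hsy : 0 < √y := Real.sqrt_pos.2 hy
  have hlog : Real.log (x / y) = -(2 * Real.log (√y / √x)) := by
    rw [Real.log_div hx.ne' hy.ne', Real.log_div hsy.ne' hsx.ne', Real.log_sqrt hx.le,
      Real.log_sqrt hy.le]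
    ring
  have h1 : Real.log (√y / √x) ≤ √y / √x - 1 := Real.log_le_sub_one_of_pos (by positivity)
  have h2 : x * (√y / √x) = √x * √y := by
    field_simp
    rw [Real.sq_sqrt hx.le]
  have h3 := mul_le_mul_of_nonneg_left h1 hx.le
  have h4 := Real.sq_sqrt hx.le
  have h5 := Real.sq_sqrt hy.le
  rw [rho, hlog]
  nlinarith

lemma abs_sub_le_of_rho {x y t : ℝ} (hx : 0 < x) (hy : 0 < y) (ht : 0 < t) :
    |x - y| ≤ (1 + 1 / t) * rho x y + t * x := by
  set d := |√x - √y| with hd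
  have hd0 : 0 ≤ d := abs_nonneg _
  have hR : d ^ 2 ≤ rho x y := by
    rw [hd, sq_abs]; exact sq_sqrt_sub_sqrt_le_rho hx hy
  have hsx : 0 ≤ √x := Real.sqrt_nonneg x
  have hsy : 0 ≤ √y := Real.sqrt_nonneg y
  have hxy : |x - y| = d * (√x + √y) := by
    have h : x - y = (√x - √y) * (√x + √y) := by
      linear_combination Real.sq_sqrt hy.le - Real.sq_sqrt hx.le
    rw [h, abs_mul, abs_of_nonneg (add_nonneg hsx hsy)]
  have h1 : √y ≤ √x + d := by
    have := neg_abs_le (√x - √y)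
    linarith
  have h2 : |x - y| ≤ d ^ 2 + 2 * √x * d := by
    rw [hxy]; nlinarith
  have h3 : 2 * √x * d ≤ t * x + 1 / t * d ^ 2 := by
    have h : t * x + 1 / t * d ^ 2 - 2 * √x * d = 1 / t * (t * √x - d) ^ 2 := by
      field_simp
      linear_combination (-t ^ 2) * Real.sq_sqrt hx.le
    have : 0 ≤ 1 / t * (t * √x - d) ^ 2 := by positivity
    linarith
  have h4 : (1 + 1 / t) * d ^ 2 ≤ (1 + 1 / t) * rho x y :=
    mul_le_mul_of_nonneg_left hR (by positivity)
  linarith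

lemma eq_of_rho_nonpos {x y : ℝ} (hx : 0 < x) (hy : 0 < y) (h : rho x y ≤ 0) : x = y := by
  have h1 : (√x - √y) ^ 2 = 0 :=
    le_antisymm ((sq_sqrt_sub_sqrt_le_rho hx hy).trans h) (sq_nonneg _)
  exact (Real.sqrt_inj hx.le hy.le).1 (sub_eq_zero.1 (pow_eq_zero_iff two_ne_zero |>.1 h1))

lemma sum_abs_sub_le_of_rho {ι : Type*} [Fintype ι] {a r : ι → ℝ} (ha : ∀ i, 0 < a i)
    (hr : ∀ i, 0 < r i) (ha1 : ∑ i, a i = 1) {t : ℝ} (ht : 0 < t) :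
    ∑ i, |a i - r i| ≤ (1 + 1 / t) * ∑ i, rho (a i) (r i) + t := by
  calc ∑ i, |a i - r i| ≤ ∑ i, ((1 + 1 / t) * rho (a i) (r i) + t * a i) :=
        Finset.sum_le_sum fun i _ => abs_sub_le_of_rho (ha i) (hr i) ht
    _ = _ := by rw [Finset.sum_add_distrib, ← Finset.mul_sum, ← Finset.mul_sum, ha1, mul_one]

lemma sq_le_of_forall_le {E R : ℝ} (hE : 0 < E)
    (h : ∀ t : ℝ, 0 < t → E ≤ (1 + 1 / t) * R + 2 * t) : E ^ 2 ≤ (8 + 2 * E) * R := by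
  have h1 := h (E / 4) (by positivity)
  have h2 := mul_le_mul_of_nonneg_left h1 hE.le
  have h3 : E * ((1 + 1 / (E / 4)) * R + 2 * (E / 4)) = (E + 4) * R + E ^ 2 / 2 := by
    field_simp
    ring
  nlinarith

/-! ### The normalized dual problem -/

namespace Greenkhorn

/-- Row sums of the plan with entries `exp (F i + G j - c i j)`. -/
noncomputable def rowSum {n : ℕ} (c : Matrix (Fin n) (Fin n) ℝ) (F G : Fin n → ℝ) (i : Fin n) :
    ℝ :=
  ∑ j, Real.exp (F i + G j - c i j)

/-- The kernel `exp (-c)` applied to `exp G`. -/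
noncomputable def kernelSum {n : ℕ} (c : Matrix (Fin n) (Fin n) ℝ) (G : Fin n → ℝ) (i : Fin n) :
    ℝ :=
  ∑ j, Real.exp (G j - c i j)

/-- The dual potential that makes the row sums equal to `a`, for a given column potential. -/
noncomputable def transform {n : ℕ} (a : Fin n → ℝ) (c : Matrix (Fin n) (Fin n) ℝ)
    (G : Fin n → ℝ) (i : Fin n) : ℝ :=
  Real.log (a i) - Real.log (kernelSum c G i)

/-- The dual objective with unit regularization. -/
noncomputable def objective {n : ℕ} (a b : Fin n → ℝ) (c : Matrix (Fin n) (Fin n) ℝ)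
    (F G : Fin n → ℝ) : ℝ :=
  (∑ i, F i * a i) + (∑ j, G j * b j) - ∑ i, ∑ j, Real.exp (F i + G j - c i j)

variable {n : ℕ} {a b : Fin n → ℝ} {c : Matrix (Fin n) (Fin n) ℝ} {F G F' G' : Fin n → ℝ}

lemma objective_transpose :
    objective b a c.transpose G F = objective a b c F G := by
  unfold objective
  rw [Finset.sum_comm]
  simp only [Matrix.transpose_apply, add_comm]

lemma kernelSum_pos [Nonempty (Fin n)] (i : Fin n) : 0 < kernelSum c G i :=
  Finset.sum_pos (fun _ _ => Real.exp_pos _) Finset.univ_nonempty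

lemma rowSum_eq (i : Fin n) : rowSum c F G i = Real.exp (F i) * kernelSum c G i := by
  simp only [rowSum, kernelSum, Finset.mul_sum, ← Real.exp_add, add_sub_assoc]

lemma rowSum_pos [Nonempty (Fin n)] (i : Fin n) : 0 < rowSum c F G i :=
  Finset.sum_pos (fun _ _ => Real.exp_pos _) Finset.univ_nonempty

lemma objective_eq : objective a b c F G =
    ∑ i, (F i * a i - Real.exp (F i) * kernelSum c G i) + ∑ j, G j * b j := by
  have h : ∀ i, ∑ j, Real.exp (F i + G j - c i j) = Real.exp (F i) * kernelSum c G i :=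
    fun i => rowSum_eq i
  simp only [objective, h, Finset.sum_sub_distrib]
  ring

lemma exp_transform_mul [Nonempty (Fin n)] (ha : ∀ i, 0 < a i) (i : Fin n) :
    Real.exp (transform a c G i) * kernelSum c G i = a i := by
  rw [transform, Real.exp_sub, Real.exp_log (ha i), Real.exp_log (kernelSum_pos i),
    div_mul_cancel₀ _ (kernelSum_pos i).ne']

lemma objective_update [Nonempty (Fin n)] (ha : ∀ i, 0 < a i) (I : Fin n) :
    objective a b c (Function.update F I (transform a c G I)) G =
      objective a b c F G + rho (a I) (rowSum c F G I) := by
  rw [objective_eq, objective_eq]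
  have h1 : ∀ F₁ : Fin n → ℝ, ∑ i, (F₁ i * a i - Real.exp (F₁ i) * kernelSum c G i) =
      (F₁ I * a I - Real.exp (F₁ I) * kernelSum c G I) +
        ∑ i ∈ Finset.univ.erase I, (F₁ i * a i - Real.exp (F₁ i) * kernelSum c G i) :=
    fun F₁ => (Finset.add_sum_erase _ _ (Finset.mem_univ I)).symm
  have h2 : ∑ i ∈ Finset.univ.erase I,
      (Function.update F I (transform a c G I) i * a i -
        Real.exp (Function.update F I (transform a c G I) i) * kernelSum c G i) =
      ∑ i ∈ Finset.univ.erase I, (F i * a i - Real.exp (F i) * kernelSum c G i) := by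
    refine Finset.sum_congr rfl fun i hi => ?_
    rw [Function.update_of_ne (Finset.ne_of_mem_erase hi)]
  have h3 : Real.log (a I / rowSum c F G I) = transform a c G I - F I := by
    rw [Real.log_div (ha I).ne' (rowSum_pos I).ne', rowSum_eq,
      Real.log_mul (Real.exp_pos _).ne' (kernelSum_pos I).ne', Real.log_exp, transform]
    ring
  rw [h1, h1 F, h2, Function.update_self, exp_transform_mul ha, rho, h3, rowSum_eq]
  ring

lemma objective_le_transform [Nonempty (Fin n)] (ha : ∀ i, 0 < a i) :
    objective a b c F G ≤ objective a b c (transform a c G) G := by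
  rw [objective_eq, objective_eq]
  refine add_le_add (Finset.sum_le_sum fun i _ => ?_) le_rfl
  have h1 := Real.add_one_le_exp (F i - transform a c G i)
  have h2 : Real.exp (F i) * kernelSum c G i =
      Real.exp (F i - transform a c G i) * a i := by
    rw [← exp_transform_mul (a := a) (c := c) (G := G) ha i, ← mul_assoc, ← Real.exp_add]
    congr 2; ring
  rw [exp_transform_mul ha, h2]
  nlinarith [mul_le_mul_of_nonneg_right h1 (ha i).le]

lemma objective_translate (hab : ∑ i, a i = ∑ j, b j) (s : ℝ) :
    objective a b c (fun i => F i + s) (fun j => G j - s) = objective a b c F G := by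
  have h : ∀ i j, F i + s + (G j - s) - c i j = F i + G j - c i j := fun i j => by ring
  simp only [objective, h, add_mul, sub_mul, Finset.sum_add_distrib, Finset.sum_sub_distrib,
    ← Finset.mul_sum, hab]
  ring

lemma kernelSum_le (hc : ∀ i j, 0 ≤ c i j) (i : Fin n) :
    kernelSum c G i ≤ ∑ j, Real.exp (G j) :=
  Finset.sum_le_sum fun j _ => Real.exp_le_exp.2 (by linarith [hc i j])

lemma le_kernelSum {m : ℝ} (hcm : ∀ i j, c i j ≤ m) (i : Fin n) :
    Real.exp (-m) * ∑ j, Real.exp (G j) ≤ kernelSum c G i := by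
  rw [Finset.mul_sum]
  refine Finset.sum_le_sum fun j _ => ?_
  rw [← Real.exp_add]
  exact Real.exp_le_exp.2 (by linarith [hcm i j])

lemma log_kernelSum_mem [Nonempty (Fin n)] {m : ℝ} (hc : ∀ i j, 0 ≤ c i j)
    (hcm : ∀ i j, c i j ≤ m) (i : Fin n) :
    Real.log (kernelSum c G i) ∈
      Set.Icc (Real.log (∑ j, Real.exp (G j)) - m) (Real.log (∑ j, Real.exp (G j))) := by
  have hZ : 0 < ∑ j, Real.exp (G j) :=
    Finset.sum_pos (fun _ _ => Real.exp_pos _) Finset.univ_nonempty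
  constructor
  · have := Real.log_le_log (by positivity) (le_kernelSum (G := G) hcm i)
    rw [Real.log_mul (Real.exp_pos _).ne' hZ.ne', Real.log_exp] at this
    linarith
  · exact Real.log_le_log (kernelSum_pos i) (kernelSum_le hc i)

lemma transform_sub_le [Nonempty (Fin n)] {m : ℝ} (h : ∀ j, G' j ≤ G j + m) (i : Fin n) :
    transform a c G i - transform a c G' i ≤ m := by
  have h1 : kernelSum c G' i ≤ Real.exp m * kernelSum c G i := by
    rw [kernelSum, kernelSum, Finset.mul_sum]
    refine Finset.sum_le_sum fun j _ => ?_
    rw [← Real.exp_add]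
    exact Real.exp_le_exp.2 (by linarith [h j])
  have h2 := Real.log_le_log (kernelSum_pos i) h1
  rw [Real.log_mul (Real.exp_pos _).ne' (kernelSum_pos i).ne', Real.log_exp] at h2
  rw [transform, transform]
  linarith

lemma abs_transform_sub_le [Nonempty (Fin n)] {m : ℝ} (h : ∀ j, |G j - G' j| ≤ m) (i : Fin n) :
    |transform a c G i - transform a c G' i| ≤ m := by
  refine abs_sub_le_iff.2 ⟨transform_sub_le (fun j => ?_) i, transform_sub_le (fun j => ?_) i⟩
  · linarith [(abs_le.1 (h j)).1]
  · linarith [(abs_le.1 (h j)).2]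

lemma abs_update_transform_sub_le [Nonempty (Fin n)] {m : ℝ} (hF : ∀ i, |F i - F' i| ≤ m)
    (hG : ∀ j, |G j - G' j| ≤ m) (hfix : ∀ i, F' i = transform a c G' i) (I i : Fin n) :
    |Function.update F I (transform a c G I) i - F' i| ≤ m := by
  rcases eq_or_ne i I with rfl | hi
  · rw [Function.update_self, hfix]
    exact abs_transform_sub_le hG i
  · rw [Function.update_of_ne hi]
    exact hF i

/-- Every pair of potentials is dominated by one within distance `m` of `(log a, log b)`. -/
lemma exists_le_objective [Nonempty (Fin n)] {m : ℝ} (ha : ∀ i, 0 < a i) (hb : ∀ j, 0 < b j)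
    (ha1 : ∑ i, a i = 1) (hb1 : ∑ j, b j = 1) (hc : ∀ i j, 0 ≤ c i j) (hcm : ∀ i j, c i j ≤ m)
    (F G : Fin n → ℝ) :
    ∃ F₁ G₁ : Fin n → ℝ, (∀ i, |F₁ i - Real.log (a i)| ≤ m) ∧
      (∀ j, |G₁ j - Real.log (b j)| ≤ m) ∧ objective a b c F G ≤ objective a b c F₁ G₁ := by
  set G₀ := transform b c.transpose F with hG₀
  set Z := ∑ j, Real.exp (G₀ j) with hZ
  set W := ∑ i, Real.exp (F i) with hW
  have hm : 0 ≤ m := (hc (Classical.arbitrary _) (Classical.arbitrary _)).trans (hcm _ _)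
  have hZ0 : 0 < Z := Finset.sum_pos (fun _ _ => Real.exp_pos _) Finset.univ_nonempty
  have hS := fun j => log_kernelSum_mem (c := c.transpose) (G := F) (m := m)
    (fun i j => hc j i) (fun i j => hcm j i) j
  have hlo : -Real.log W ≤ Real.log Z := by
    rw [Real.le_log_iff_exp_le hZ0, hZ]
    calc Real.exp (-Real.log W) = ∑ j, b j * Real.exp (-Real.log W) := by
          rw [← Finset.sum_mul, hb1, one_mul]
      _ ≤ _ := by
          refine Finset.sum_le_sum fun j _ => ?_
          nth_rw 1 [← Real.exp_log (hb j)]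
          rw [← Real.exp_add, hG₀, transform]
          exact Real.exp_le_exp.2 (by linarith [(hS j).2])
  have hhi : Real.log Z ≤ m - Real.log W := by
    rw [Real.log_le_iff_le_exp hZ0, hZ]
    calc _ ≤ ∑ j, b j * Real.exp (m - Real.log W) := by
          refine Finset.sum_le_sum fun j _ => ?_
          nth_rw 1 [← Real.exp_log (hb j)]
          rw [← Real.exp_add, hG₀, transform]
          exact Real.exp_le_exp.2 (by linarith [(hS j).1])
      _ = _ := by rw [← Finset.sum_mul, hb1, one_mul]
  set G₁ : Fin n → ℝ := fun j => G₀ j - Real.log Z with hG₁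
  have hZ1 : ∑ j, Real.exp (G₁ j) = 1 := by
    simp only [hG₁, Real.exp_sub, Real.exp_log hZ0, ← Finset.sum_div]
    exact div_self hZ0.ne'
  refine ⟨transform a c G₁, G₁, fun i => ?_, fun j => ?_, ?_⟩
  · have h := log_kernelSum_mem (G := G₁) hc hcm i
    rw [hZ1, Real.log_one] at h
    rw [transform, abs_le]
    constructor <;> linarith [h.1, h.2]
  · simp only [hG₁, hG₀, transform]
    rw [abs_le]
    constructor <;> linarith [(hS j).1, (hS j).2]
  · calc objective a b c F G ≤ objective a b c F G₀ := by
          rw [← objective_transpose, ← objective_transpose (G := G₀)]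
          exact objective_le_transform hb
      _ = objective a b c (fun i => F i + Real.log Z) G₁ :=
          (objective_translate (ha1.trans hb1.symm) _).symm
      _ ≤ _ := objective_le_transform ha

lemma exists_maximizer [Nonempty (Fin n)] {m : ℝ} (ha : ∀ i, 0 < a i) (hb : ∀ j, 0 < b j)
    (ha1 : ∑ i, a i = 1) (hb1 : ∑ j, b j = 1) (hc : ∀ i j, 0 ≤ c i j) (hcm : ∀ i j, c i j ≤ m) :
    ∃ F₁ G₁ : Fin n → ℝ, (∀ i, |F₁ i - Real.log (a i)| ≤ m) ∧
      (∀ j, |G₁ j - Real.log (b j)| ≤ m) ∧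
      ∀ F G, objective a b c F G ≤ objective a b c F₁ G₁ := by
  set A : Fin n → ℝ := fun i => Real.log (a i) with hA
  set B : Fin n → ℝ := fun j => Real.log (b j) with hB
  set S : Set ((Fin n → ℝ) × (Fin n → ℝ)) :=
    Set.Icc (fun i => A i - m) (fun i => A i + m) ×ˢ
      Set.Icc (fun j => B j - m) (fun j => B j + m) with hSdef
  have hmem : ∀ p : (Fin n → ℝ) × (Fin n → ℝ),
      p ∈ S ↔ (∀ i, |p.1 i - A i| ≤ m) ∧ ∀ j, |p.2 j - B j| ≤ m := by
    intro p
    simp only [hSdef, Set.mem_prod, Set.mem_Icc, Pi.le_def, abs_sub_le_iff, forall_and,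
      sub_le_iff_le_add]
    constructor
    · rintro ⟨⟨h1, h2⟩, h3, h4⟩
      refine ⟨⟨fun i => ?_, fun i => ?_⟩, fun i => ?_, fun i => ?_⟩
      · linarith [h2 i]
      · linarith [h1 i]
      · linarith [h4 i]
      · linarith [h3 i]
    · rintro ⟨⟨h1, h2⟩, h3, h4⟩
      refine ⟨⟨fun i => ?_, fun i => ?_⟩, fun i => ?_, fun i => ?_⟩
      · linarith [h2 i]
      · linarith [h1 i]
      · linarith [h4 i]
      · linarith [h3 i]
  have hcpt : IsCompact S := isCompact_Icc.prod isCompact_Icc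
  have hcont : Continuous fun p : (Fin n → ℝ) × (Fin n → ℝ) => objective a b c p.1 p.2 := by
    unfold objective
    fun_prop
  have hne : S.Nonempty := by
    obtain ⟨F₁, G₁, h1, h2, -⟩ := exists_le_objective ha hb ha1 hb1 hc hcm 0 0
    exact ⟨(F₁, G₁), (hmem _).2 ⟨h1, h2⟩⟩
  obtain ⟨p, hpS, hp⟩ := hcpt.exists_isMaxOn hne hcont.continuousOn
  refine ⟨p.1, p.2, ((hmem p).1 hpS).1, ((hmem p).1 hpS).2, fun F G => ?_⟩
  obtain ⟨F₁, G₁, h1, h2, h3⟩ := exists_le_objective ha hb ha1 hb1 hc hcm F G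
  exact h3.trans (hp ((hmem (F₁, G₁)).2 ⟨h1, h2⟩))

lemma rowSum_eq_of_isMax [Nonempty (Fin n)] (ha : ∀ i, 0 < a i)
    (hmax : ∀ F₁, objective a b c F₁ G ≤ objective a b c F G) (i : Fin n) :
    rowSum c F G i = a i := by
  have h := hmax (Function.update F i (transform a c G i))
  rw [objective_update ha] at h
  exact (eq_of_rho_nonpos (ha i) (rowSum_pos i) (by linarith)).symm

lemma eq_transform_of_rowSum_eq [Nonempty (Fin n)] {i : Fin n} (h : rowSum c F G i = a i) :
    F i = transform a c G i := by
  rw [transform, ← h, rowSum_eq, Real.log_mul (Real.exp_pos _).ne' (kernelSum_pos i).ne',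
    Real.log_exp]
  ring

/-- The total `ℓ¹` violation of the marginal constraints. -/
noncomputable def marginalError (a b : Fin n → ℝ) (c : Matrix (Fin n) (Fin n) ℝ)
    (F G : Fin n → ℝ) : ℝ :=
  (∑ i, |a i - rowSum c F G i|) + ∑ j, |b j - rowSum c.transpose G F j|

lemma sum_mul_rowSum (u : Fin n → ℝ) :
    ∑ i, u i * rowSum c F G i = ∑ i, ∑ j, u i * Real.exp (F i + G j - c i j) := by
  simp only [rowSum, Finset.mul_sum]

lemma sum_mul_le_of_abs_le {u v : Fin n → ℝ} {m : ℝ} (hu : ∀ i, |u i| ≤ m) :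
    ∑ i, u i * v i ≤ m * ∑ i, |v i| := by
  rw [Finset.mul_sum]
  refine Finset.sum_le_sum fun i _ => (le_abs_self _).trans ?_
  rw [abs_mul]
  exact mul_le_mul_of_nonneg_right (hu i) (abs_nonneg _)

/-- Concavity of the dual objective bounds the gap by the marginal error. -/
lemma objective_sub_le {m : ℝ} (hF : ∀ i, |F i - F' i| ≤ m) (hG : ∀ j, |G j - G' j| ≤ m) :
    objective a b c F' G' - objective a b c F G ≤ m * marginalError a b c F G := by
  have hcol : ∑ j, (G' j - G j) * rowSum c.transpose G F j =
      ∑ i, ∑ j, (G' j - G j) * Real.exp (F i + G j - c i j) := by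
    rw [sum_mul_rowSum, Finset.sum_comm]
    simp only [Matrix.transpose_apply, add_comm]
  have hexp : ∑ i, ∑ j, Real.exp (F i + G j - c i j) + ∑ i, (F' i - F i) * rowSum c F G i +
      ∑ j, (G' j - G j) * rowSum c.transpose G F j ≤
        ∑ i, ∑ j, Real.exp (F' i + G' j - c i j) := by
    rw [hcol, sum_mul_rowSum, ← Finset.sum_add_distrib, ← Finset.sum_add_distrib]
    refine Finset.sum_le_sum fun i _ => ?_
    rw [← Finset.sum_add_distrib, ← Finset.sum_add_distrib]
    refine Finset.sum_le_sum fun j _ => ?_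
    have h1 := Real.add_one_le_exp ((F' i - F i) + (G' j - G j))
    have h2 : Real.exp (F' i + G' j - c i j) =
        Real.exp ((F' i - F i) + (G' j - G j)) * Real.exp (F i + G j - c i j) := by
      rw [← Real.exp_add]
      congr 1; ring
    rw [h2]
    nlinarith [mul_le_mul_of_nonneg_right h1 (Real.exp_pos (F i + G j - c i j)).le]
  have hA : ∑ i, (F' i - F i) * (a i - rowSum c F G i) ≤ m * ∑ i, |a i - rowSum c F G i| :=
    sum_mul_le_of_abs_le fun i => by rw [abs_sub_comm]; exact hF i
  have hB : ∑ j, (G' j - G j) * (b j - rowSum c.transpose G F j) ≤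
      m * ∑ j, |b j - rowSum c.transpose G F j| :=
    sum_mul_le_of_abs_le fun j => by rw [abs_sub_comm]; exact hG j
  simp only [mul_sub, Finset.sum_sub_distrib] at hA hB
  simp only [sub_mul, Finset.sum_sub_distrib] at hA hB hexp
  simp only [objective, marginalError, mul_add]
  linarith

lemma objective_sub_initial_le {m : ℝ} (ha : ∀ i, 0 < a i) (hb : ∀ j, 0 < b j)
    (ha1 : ∑ i, a i = 1) (hb1 : ∑ j, b j = 1) (hc : ∀ i j, 0 ≤ c i j)
    (hF : ∀ i, |F i - Real.log (a i)| ≤ m) (hG : ∀ j, |G j - Real.log (b j)| ≤ m)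
    (hrow : ∀ i, rowSum c F G i = a i) :
    objective a b c F G -
      objective a b c (fun i => Real.log (a i)) (fun j => Real.log (b j)) ≤ 2 * m := by
  have h1 : ∑ i, ∑ j, Real.exp (F i + G j - c i j) = 1 := by
    rw [← ha1]
    exact Finset.sum_congr rfl fun i _ => hrow i
  have h2 : ∑ i, ∑ j, Real.exp (Real.log (a i) + Real.log (b j) - c i j) ≤ 1 := by
    calc _ ≤ ∑ i, ∑ j, a i * b j := by
          refine Finset.sum_le_sum fun i _ => Finset.sum_le_sum fun j _ => ?_
          nth_rw 2 [← Real.exp_log (ha i), ← Real.exp_log (hb j)]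
          rw [← Real.exp_add]
          exact Real.exp_le_exp.2 (by linarith [hc i j])
      _ = 1 := by rw [← Finset.sum_mul_sum, ha1, hb1, one_mul]
  have h3 := sum_mul_le_of_abs_le (v := a) hF
  have h4 := sum_mul_le_of_abs_le (v := b) hG
  simp only [abs_of_pos (ha _), ha1, abs_of_pos (hb _), hb1] at h3 h4
  simp only [sub_mul, Finset.sum_sub_distrib] at h3 h4
  simp only [objective]
  linarith

/-- If every coordinate divergence is at most `p`, the marginal error is controlled by `p`. -/
lemma sq_marginalError_le [Nonempty (Fin n)] {p : ℝ} (ha : ∀ i, 0 < a i) (hb : ∀ j, 0 < b j)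
    (ha1 : ∑ i, a i = 1) (hb1 : ∑ j, b j = 1) (hE : 0 < marginalError a b c F G)
    (hr : ∀ i, rho (a i) (rowSum c F G i) ≤ p)
    (hs : ∀ j, rho (b j) (rowSum c.transpose G F j) ≤ p) :
    marginalError a b c F G ^ 2 ≤ (8 + 2 * marginalError a b c F G) * (2 * n * p) := by
  have h1 : ∑ i, rho (a i) (rowSum c F G i) ≤ n * p := by
    simpa using Finset.sum_le_card_nsmul Finset.univ _ p fun i _ => hr i
  have h2 : ∑ j, rho (b j) (rowSum c.transpose G F j) ≤ n * p := by
    simpa using Finset.sum_le_card_nsmul Finset.univ _ p fun j _ => hs j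
  refine sq_le_of_forall_le hE fun t ht => ?_
  have h3 := sum_abs_sub_le_of_rho ha (fun i => rowSum_pos (c := c) (F := F) (G := G) i) ha1 ht
  have h4 := sum_abs_sub_le_of_rho hb
    (fun j => rowSum_pos (c := c.transpose) (F := G) (G := F) j) hb1 ht
  have h5 := mul_le_mul_of_nonneg_left (add_le_add h1 h2) (show 0 ≤ 1 + 1 / t by positivity)
  rw [marginalError]
  linarith

/-! ### Counting iterations -/

/-- The potential used to count iterations drops by at least one along each step. -/
lemma potential_drop {N m δ x y E : ℝ} (hN : 0 < N) (hδ : 0 < δ) (hm : 0 < m) (hy : 0 ≤ y)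
    (hEδ : δ < E) (hxE : x ≤ m * E) (hdrop : E ^ 2 ≤ (8 + 2 * E) * (2 * N * (x - y))) :
    (4 * N * y + 112 * N * m / δ * (y / (y + m * δ))) + 1 ≤
      4 * N * x + 112 * N * m / δ * (x / (x + m * δ)) := by
  have hE : 0 < E := hδ.trans hEδ
  have hxy : 0 < x - y := by
    have : 0 < (8 + 2 * E) * (2 * N * (x - y)) := lt_of_lt_of_le (by positivity) hdrop
    have := pos_of_mul_pos_right this (by positivity)
    exact pos_of_mul_pos_right this (by positivity)
  have hx : 0 < x := by linarith
  have hτ : 0 < m * δ := by positivity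
  have key : 112 * N * m / δ * (x / (x + m * δ)) - 112 * N * m / δ * (y / (y + m * δ)) =
      112 * N * m ^ 2 * (x - y) / ((x + m * δ) * (y + m * δ)) := by
    field_simp
    ring
  have hnonneg : 0 ≤ 112 * N * m ^ 2 * (x - y) / ((x + m * δ) * (y + m * δ)) := by positivity
  rcases le_or_gt E 3 with h3 | h3
  · have hp : E ^ 2 ≤ 28 * N * (x - y) := by
      have : 0 ≤ (3 - E) * (2 * N * (x - y)) := mul_nonneg (by linarith) (by positivity)
      nlinarith
    have hone : 1 ≤ 112 * N * m ^ 2 * (x - y) / ((x + m * δ) * (y + m * δ)) := by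
      rw [one_le_div (by positivity)]
      have h1 : x + m * δ ≤ 2 * (m * E) := by nlinarith
      have h2 : y + m * δ ≤ 2 * (m * E) := by linarith
      calc (x + m * δ) * (y + m * δ) ≤ (2 * (m * E)) * (2 * (m * E)) := by gcongr
        _ = 4 * m ^ 2 * E ^ 2 := by ring
        _ ≤ 4 * m ^ 2 * (28 * N * (x - y)) := by gcongr
        _ = _ := by ring
    have : 0 < 4 * N * (x - y) := by positivity
    linarith
  · have hp : 1 ≤ 4 * N * (x - y) := by
      by_contra! hlt
      have : (8 + 2 * E) * (2 * N * (x - y)) ≤ (8 + 2 * E) * (1 / 2) :=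
        mul_le_mul_of_nonneg_left (by linarith) (by positivity)
      nlinarith
    linarith

lemma exists_error_le {N m δ : ℝ} (hN : 0 < N) (hδ : 0 < δ) (hm : 0 ≤ m) {Δ E : ℕ → ℝ}
    (hΔ : ∀ k, 0 ≤ Δ k) (hΔ0 : Δ 0 ≤ 2 * m) (hΔE : ∀ k, Δ k ≤ m * E k)
    (hdrop : ∀ k, 0 < E k → E k ^ 2 ≤ (8 + 2 * E k) * (2 * N * (Δ k - Δ (k + 1)))) (K : ℕ)
    (hK : 112 * N * m / δ + 8 * N * m ≤ K) : ∃ k ≤ K, E k ≤ δ := by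
  by_contra! hcon
  have hm0 : 0 < m := by
    refine hm.lt_of_ne' fun h => ?_
    have hE := hδ.trans (hcon 0 (Nat.zero_le _))
    have h0 : Δ 0 ≤ 0 := by simpa [h] using hΔ0
    have h1 := hdrop 0 hE
    have h2 : (8 + 2 * E 0) * (2 * N * (Δ 0 - Δ (0 + 1))) ≤ 0 :=
      mul_nonpos_of_nonneg_of_nonpos (by positivity)
        (mul_nonpos_of_nonneg_of_nonpos (by positivity) (by linarith [hΔ (0 + 1)]))
    have h3 : 0 < E 0 ^ 2 := by positivity
    linarith
  set Φ : ℕ → ℝ := fun k => 4 * N * Δ k + 112 * N * m / δ * (Δ k / (Δ k + m * δ)) with hΦ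
  have hind : ∀ k ≤ K + 1, Φ k + k ≤ Φ 0 := by
    intro k
    induction k with
    | zero => intro _; simp
    | succ k ih =>
      intro hk
      have hE := hcon k (by omega)
      have h1 : Φ (k + 1) + 1 ≤ Φ k := potential_drop hN hδ hm0 (hΔ (k + 1)) hE (hΔE k)
        (hdrop k (hδ.trans hE))
      have h2 := ih (by omega)
      push_cast
      linarith
  have hlast := hind (K + 1) le_rfl
  have hpos : 0 ≤ Φ (K + 1) := by
    have := hΔ (K + 1)
    simp only [hΦ]
    positivity
  have hinit : Φ 0 ≤ 112 * N * m / δ + 8 * N * m := by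
    have h0 := hΔ 0
    have h1 : Δ 0 / (Δ 0 + m * δ) ≤ 1 := by
      rw [div_le_one (by positivity)]
      have : 0 < m * δ := by positivity
      linarith
    have h2 := mul_le_mul_of_nonneg_left h1 (show 0 ≤ 112 * N * m / δ by positivity)
    have h3 := mul_le_mul_of_nonneg_left hΔ0 (show 0 ≤ 4 * N by positivity)
    simp only [hΦ]
    linarith
  push_cast at hlast
  linarith

/-! ### Normalizing the iterates -/

lemma sum_plan_row (C : Matrix (Fin n) (Fin n) ℝ) (γ : ℝ) (f g : Fin n → ℝ) (i : Fin n) :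
    ∑ j, plan C γ f g i j =
      rowSum (fun i j => C i j / γ) (fun i => f i / γ) (fun j => g j / γ) i := by
  refine Finset.sum_congr rfl fun j _ => ?_
  rw [plan, ← Real.exp_add, ← Real.exp_add]
  congr 1; ring

lemma sum_plan_col (C : Matrix (Fin n) (Fin n) ℝ) (γ : ℝ) (f g : Fin n → ℝ) (j : Fin n) :
    ∑ i, plan C γ f g i j =
      rowSum (Matrix.transpose fun i j => C i j / γ) (fun j => g j / γ) (fun i => f i / γ) j := by
  refine Finset.sum_congr rfl fun i _ => ?_
  change _ = Real.exp (g j / γ + f i / γ - C i j / γ)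
  rw [plan, ← Real.exp_add, ← Real.exp_add]
  congr 1; ring

lemma update_div_eq {γ : ℝ} (hγ : 0 < γ) (f g : Fin n → ℝ) (C : Matrix (Fin n) (Fin n) ℝ)
    (I : Fin n) :
    (fun i => Function.update f I (γ * Real.log (a I) -
        γ * Real.log (∑ j, Real.exp (-C I j / γ) * Real.exp (g j / γ))) i / γ) =
      Function.update (fun i => f i / γ) I
        (transform a (fun i j => C i j / γ) (fun j => g j / γ) I) := by
  have h : ∑ j, Real.exp (-C I j / γ) * Real.exp (g j / γ) =
      kernelSum (fun i j => C i j / γ) (fun j => g j / γ) I := by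
    refine Finset.sum_congr rfl fun j _ => ?_
    rw [← Real.exp_add]
    congr 1; ring
  funext i
  rcases eq_or_ne i I with rfl | hi
  · rw [Function.update_self, Function.update_self, h, ← mul_sub,
      mul_div_cancel_left₀ _ hγ.ne']
    rfl
  · rw [Function.update_of_ne hi, Function.update_of_ne hi]

/-- One step of the algorithm in normalized potentials: the updated pair is obtained by an exact
maximization along a row or a column coordinate, whose divergence dominates all the others. -/
lemma step_cases {C : Matrix (Fin n) (Fin n) ℝ} {γ : ℝ} (hγ : 0 < γ) {f g : ℕ → Fin n → ℝ}
    (hiter : GreenkhornSeq a b C γ f g) (hcC : c = fun i j => C i j / γ) (k : ℕ)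
    (hF : F = fun i => f k i / γ) (hG : G = fun j => g k j / γ) :
    ∃ p : ℝ, (∀ i, rho (a i) (rowSum c F G i) ≤ p) ∧
      (∀ j, rho (b j) (rowSum c.transpose G F j) ≤ p) ∧
      ((∃ I, p = rho (a I) (rowSum c F G I) ∧
          (fun i => f (k + 1) i / γ) = Function.update F I (transform a c G I) ∧
          (fun j => g (k + 1) j / γ) = G) ∨
        ∃ J, p = rho (b J) (rowSum c.transpose G F J) ∧
          (fun i => f (k + 1) i / γ) = F ∧
          (fun j => g (k + 1) j / γ) = Function.update G J (transform b c.transpose F J)) := by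
  obtain ⟨I, J, hI, hJ, hrow, hcol⟩ := hiter.2.2 k
  subst hcC hF hG
  simp only [sum_plan_row, sum_plan_col] at hI hJ hrow hcol
  by_cases h : rho (b J) (rowSum (Matrix.transpose fun i j => C i j / γ)
      (fun j => g k j / γ) (fun i => f k i / γ) J) <
        rho (a I) (rowSum (fun i j => C i j / γ) (fun i => f k i / γ) (fun j => g k j / γ) I)
  · obtain ⟨h1, h2⟩ := hrow h
    refine ⟨_, hI, fun j => (hJ j).trans h.le, Or.inl ⟨I, rfl, ?_, by rw [h2]⟩⟩
    rw [h1]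
    exact update_div_eq hγ (f k) (g k) C I
  · obtain ⟨h1, h2⟩ := hcol h
    refine ⟨_, fun i => (hI i).trans (not_lt.1 h), hJ, Or.inr ⟨J, rfl, by rw [h1], ?_⟩⟩
    rw [h2]
    exact update_div_eq hγ (g k) (f k) C.transpose J

end Greenkhorn

/-- **Iteration complexity of the vanilla Greenkhorn algorithm** (Theorem 2 of the
paper): for any accuracy `δ > 0`, there is an iteration index
`k ≤ 2⌈56n‖C‖_∞/(γδ)⌉ + 2⌈4n‖C‖_∞/γ⌉` such that
`‖a − P_k𝟏‖₁ + ‖b − P_kᵀ𝟏‖₁ ≤ δ`. -/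
theorem greenkhorn_iteration_complexity {n : ℕ} (a b : Fin n → ℝ)
    (C : Matrix (Fin n) (Fin n) ℝ) (γ : ℝ) (hγ : 0 < γ)
    (ha0 : ∀ i, 0 < a i) (hb0 : ∀ j, 0 < b j)
    (ha1 : ∑ i, a i = 1) (hb1 : ∑ j, b j = 1)
    (hC : ∀ i j, 0 ≤ C i j)
    (f g : ℕ → Fin n → ℝ) (hiter : GreenkhornSeq a b C γ f g)
    (δ : ℝ) (hδ : 0 < δ) :
    ∃ k : ℕ,
      (k : ℤ) ≤ 2 * ⌈56 * n * (⨆ i, ⨆ j, |C i j|) / (γ * δ)⌉ +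
        2 * ⌈4 * n * (⨆ i, ⨆ j, |C i j|) / γ⌉ ∧
      (∑ i, |a i - ∑ j, plan C γ (f k) (g k) i j|) +
        (∑ j, |b j - ∑ i, plan C γ (f k) (g k) i j|) ≤ δ := by
  have hn : Nonempty (Fin n) := by
    by_contra h
    rw [not_nonempty_iff] at h
    simp at ha1
  have hn0 : (0 : ℝ) < n := by
    exact_mod_cast Fin.pos_iff_nonempty.2 hn
  set M := ⨆ i, ⨆ j, |C i j| with hM
  have hCM : ∀ i j, C i j ≤ M := fun i j =>
    (le_abs_self _).trans ((le_ciSup (f := fun j => |C i j|) (Set.finite_range _).bddAbove j).trans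
      (le_ciSup (f := fun i => ⨆ j, |C i j|) (Set.finite_range _).bddAbove i))
  have hM0 : 0 ≤ M := (hC (Classical.arbitrary _) (Classical.arbitrary _)).trans (hCM _ _)
  set c : Matrix (Fin n) (Fin n) ℝ := fun i j => C i j / γ with hc
  have hc0 : ∀ i j, 0 ≤ c i j := fun i j => div_nonneg (hC i j) hγ.le
  have hcm : ∀ i j, c i j ≤ M / γ := fun i j => div_le_div_of_nonneg_right (hCM i j) hγ.le
  set F : ℕ → Fin n → ℝ := fun k i => f k i / γ with hF
  set G : ℕ → Fin n → ℝ := fun k j => g k j / γ with hG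
  obtain ⟨F', G', hF', hG', hmax⟩ := Greenkhorn.exists_maximizer ha0 hb0 ha1 hb1 hc0 hcm
  have hrow : ∀ i, Greenkhorn.rowSum c F' G' i = a i :=
    Greenkhorn.rowSum_eq_of_isMax (b := b) ha0 fun F₁ => hmax F₁ G'
  have hcol : ∀ j, Greenkhorn.rowSum c.transpose G' F' j = b j :=
    Greenkhorn.rowSum_eq_of_isMax (b := a) hb0 fun G₁ => by
      rw [Greenkhorn.objective_transpose, Greenkhorn.objective_transpose]
      exact hmax F' G₁
  have hF0 : F 0 = fun i => Real.log (a i) := by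
    funext i
    simp only [hF, hiter.1]
    field_simp
  have hG0 : G 0 = fun j => Real.log (b j) := by
    funext j
    simp only [hG, hiter.2.1]
    field_simp
  have hclose : ∀ k, (∀ i, |F k i - F' i| ≤ M / γ) ∧ ∀ j, |G k j - G' j| ≤ M / γ := by
    intro k
    induction k with
    | zero =>
      rw [hF0, hG0]
      exact ⟨fun i => by rw [abs_sub_comm]; exact hF' i,
        fun j => by rw [abs_sub_comm]; exact hG' j⟩
    | succ k ih =>
      obtain ⟨p, -, -, ⟨I, -, h1, h2⟩ | ⟨J, -, h1, h2⟩⟩ :=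
        Greenkhorn.step_cases hγ hiter hc k (F := F k) (G := G k) rfl rfl
      · change F (k + 1) = _ at h1
        change G (k + 1) = _ at h2
        rw [h1, h2]
        refine ⟨?_, ih.2⟩
        exact Greenkhorn.abs_update_transform_sub_le ih.1 ih.2
          (fun i => Greenkhorn.eq_transform_of_rowSum_eq (hrow i)) I
      · change F (k + 1) = _ at h1
        change G (k + 1) = _ at h2
        rw [h1, h2]
        refine ⟨ih.1, ?_⟩
        exact Greenkhorn.abs_update_transform_sub_le ih.2 ih.1
          (fun j => Greenkhorn.eq_transform_of_rowSum_eq (hcol j)) J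
  have hbound : 112 * n * (M / γ) / δ + 8 * n * (M / γ) ≤
      ((2 * ⌈56 * n * M / (γ * δ)⌉ + 2 * ⌈4 * n * M / γ⌉ : ℤ) : ℝ) := by
    have h1 := Int.le_ceil (56 * n * M / (γ * δ))
    have h2 := Int.le_ceil (4 * n * M / γ)
    have h3 : 112 * n * (M / γ) / δ = 2 * (56 * n * M / (γ * δ)) := by field_simp; ring
    have h4 : 8 * n * (M / γ) = 2 * (4 * n * M / γ) := by ring
    push_cast
    linarith
  have hMγ : 0 ≤ M / γ := div_nonneg hM0 hγ.le
  have hnonneg : 0 ≤ 2 * ⌈56 * n * M / (γ * δ)⌉ + 2 * ⌈4 * n * M / γ⌉ := by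
    have h1 : 0 ≤ ⌈56 * n * M / (γ * δ)⌉ := Int.ceil_nonneg (by positivity)
    have h2 : 0 ≤ ⌈4 * n * M / γ⌉ := Int.ceil_nonneg (by positivity)
    omega
  obtain ⟨K, hK⟩ := Int.eq_ofNat_of_zero_le hnonneg
  obtain ⟨k, hkK, hk⟩ := Greenkhorn.exists_error_le hn0 hδ hMγ
    (Δ := fun k => Greenkhorn.objective a b c F' G' - Greenkhorn.objective a b c (F k) (G k))
    (E := fun k => Greenkhorn.marginalError a b c (F k) (G k))
    (fun k => sub_nonneg.2 (hmax _ _))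
    (by
      simp only [hF0, hG0]
      exact Greenkhorn.objective_sub_initial_le ha0 hb0 ha1 hb1 hc0 hF' hG' hrow)
    (fun k => Greenkhorn.objective_sub_le (hclose k).1 (hclose k).2)
    (fun k hE => by
      obtain ⟨p, hr, hs, hstep⟩ :=
        Greenkhorn.step_cases hγ hiter hc k (F := F k) (G := G k) rfl rfl
      have hgain : Greenkhorn.objective a b c (F (k + 1)) (G (k + 1)) =
          Greenkhorn.objective a b c (F k) (G k) + p := by
        rcases hstep with ⟨I, hp, h1, h2⟩ | ⟨J, hp, h1, h2⟩
        · change F (k + 1) = _ at h1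
          change G (k + 1) = _ at h2
          rw [h1, h2, hp, Greenkhorn.objective_update ha0]
        · change F (k + 1) = _ at h1
          change G (k + 1) = _ at h2
          rw [h1, h2, hp, ← Greenkhorn.objective_transpose, Greenkhorn.objective_update hb0,
            Greenkhorn.objective_transpose]
      have h := Greenkhorn.sq_marginalError_le ha0 hb0 ha1 hb1 hE hr hs
      simp only [hgain]
      convert h using 3
      ring) K (by rw [hK] at hbound; exact_mod_cast hbound)
  refine ⟨k, ?_, ?_⟩
  · rw [hK]
    exact_mod_cast hkK
  · simp only [Greenkhorn.sum_plan_row, Greenkhorn.sum_plan_col]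
    exact hk
end
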